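/- arXiv:1804.09418 — 2 statements merged into one kernel-verified Lean document; each statement's English description precedes it below -/
import Mathlib

section
/- Fix a ∈ [0,1), σ > 0 and d ∈ (0, d_max). For every constant α > 0 there exist constants q > 1, β₁ > 0, β₂ ∈ ℝ, κ > 0 and K > 0 such that for all sufficiently large n: P[ log( 1 / P_{Y*}(B(X^n, d)) ) ≤ J_n(X^n, d) + β₁ (log n)^q + β₂ ] ≥ 1 − K/(log n)^{κα}, where X^n = (X_1, …, X_n) has independent coordinates X_i ~ N(0, σ_i²), P_{Y*} is the law of the vector with independent coordinates Y*_i ~ N(0, max(0, σ_i² − θ_n)), and B(x, d) = { y ∈ ℝⁿ : (1/n)‖x − y‖₂² ≤ d }. -/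
open MeasureTheory ProbabilityTheory Real Filter Matrix
open scoped NNReal ENNReal

noncomputable section

namespace GM

/-- Law of `n` i.i.d. centered Gaussian random variables with variance `σ²`. -/
def gaussPi (σ : ℝ) (n : ℕ) : Measure (Fin n → ℝ) :=
  Measure.pi fun _ => gaussianReal 0 ⟨σ ^ 2, sq_nonneg σ⟩

/-- The Gauss-Markov evolution `U_{i+1} = ∑_{j ≤ i} a^(i-j) Z_{j+1}`
(equivalently `U_0 = 0`, `U_i = a U_{i-1} + Z_i`). -/
def evolve (a : ℝ) (n : ℕ) (z : Fin n → ℝ) : Fin n → ℝ :=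
  fun i => ∑ j ∈ Finset.Iic i, a ^ ((i : ℕ) - (j : ℕ)) * z j

/-- Law of the Gauss-Markov source vector `(U_1, …, U_n)`. -/
def sourceLaw (a σ : ℝ) (n : ℕ) : Measure (Fin n → ℝ) :=
  (gaussPi σ n).map (evolve a n)

/-- Mean squared error distortion. -/
def distortion (n : ℕ) (u v : Fin n → ℝ) : ℝ :=
  (1 / (n : ℝ)) * ∑ i, (u i - v i) ^ 2

/-- There exists an `(n, M, d, ε)` excess-distortion code for the Gauss-Markov source. -/
def IsCode (a σ : ℝ) (n M : ℕ) (d ε : ℝ) : Prop :=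
  ∃ f : (Fin n → ℝ) → Fin M, ∃ g : Fin M → (Fin n → ℝ),
    Measurable f ∧
    sourceLaw a σ n {u | d < distortion n u (g (f u))} ≤ ENNReal.ofReal ε

/-- Minimum achievable code size. -/
def Mstar (a σ : ℝ) (n : ℕ) (d ε : ℝ) : ℕ := sInf {M | IsCode a σ n M d ε}

/-- Minimum achievable source coding rate `R(n, d, ε)`. -/
def rate (a σ : ℝ) (n : ℕ) (d ε : ℝ) : ℝ := Real.log (Mstar a σ n d ε) / n

/-- Gaussian tail function `Q`. -/
def gaussQ (t : ℝ) : ℝ := ∫ s in Set.Ioi t, (Real.sqrt (2 * π))⁻¹ * Real.exp (-(s ^ 2) / 2)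

/-- Power spectrum of the Gauss-Markov source. -/
def S (a σ w : ℝ) : ℝ := σ ^ 2 / (1 + a ^ 2 - 2 * a * Real.cos w)

/-- The limiting reverse waterfilling equation relating distortion `d` and water level `θ`. -/
def waterEq (a σ θ d : ℝ) : Prop :=
  d = (1 / (2 * π)) * ∫ w in Set.Icc (-π) π, min θ (S a σ w)

/-- The rate-distortion function `R_U(d)`, parametrized by the water level `θ` matched to `d`. -/
def RU (a σ θ : ℝ) : ℝ :=
  (1 / (2 * π)) * ∫ w in Set.Icc (-π) π, max 0 ((1 / 2) * Real.log (S a σ w / θ))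

/-- The dispersion `V_U(d)`, parametrized by the water level `θ` matched to `d`. -/
def VU (a σ θ : ℝ) : ℝ :=
  (1 / (4 * π)) * ∫ w in Set.Icc (-π) π, min 1 ((S a σ w / θ) ^ 2)

/-- The lower bidiagonal matrix `A` with `1` on the diagonal, `-a` on the first subdiagonal. -/
def Amat (a : ℝ) (n : ℕ) : Matrix (Fin n) (Fin n) ℝ :=
  Matrix.of fun i j => if i = j then 1 else if (i : ℕ) = (j : ℕ) + 1 then -a else 0

/-- `μv` is the nondecreasing enumeration of the eigenvalues (with multiplicity) of the
real symmetric matrix `M`: it is monotone and `M = P D Pᵀ` for some orthogonal `P`. -/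
def IsEigs {n : ℕ} (μv : Fin n → ℝ) (M : Matrix (Fin n) (Fin n) ℝ) : Prop :=
  Monotone μv ∧ ∃ P : Matrix (Fin n) (Fin n) ℝ,
    P * Pᵀ = 1 ∧ Pᵀ * P = 1 ∧ M = P * Matrix.diagonal μv * Pᵀ

/-- The `i`-th entry of `u` (0-based), or `0` if out of range. -/
def entry {n : ℕ} (u : Fin n → ℝ) (i : ℕ) : ℝ := if h : i < n then u ⟨i, h⟩ else 0

/-- Maximum likelihood estimator `â(u) = (∑_{i=1}^{n-1} u_i u_{i+1}) / (∑_{i=1}^{n-1} u_i²)`. -/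
def mle {n : ℕ} (u : Fin n → ℝ) : ℝ :=
  (∑ i ∈ Finset.range (n - 1), entry u i * entry u (i + 1)) /
    ∑ i ∈ Finset.range (n - 1), entry u i ^ 2

/-- The `d`-tilted information expression, parametrized by a water level `θ`,
per-coordinate variances `sv`, evaluated at the point `x`. -/
def Jtilt {n : ℕ} (θ : ℝ) (sv : Fin n → ℝ) (x : Fin n → ℝ) : ℝ :=
  ∑ i, ((min θ (sv i) / (2 * θ)) * ((x i) ^ 2 / sv i - 1)
        + (1 / 2) * Real.log (max θ (sv i) / θ))

end GM

namespace GMP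

lemma Amat_apply_split (a : ℝ) (n : ℕ) (i j : Fin n) :
    GM.Amat a n i j = (if i = j then 1 else 0) - a * (if (i : ℕ) = (j : ℕ) + 1 then 1 else 0) := by
  unfold GM.Amat
  by_cases h : i = j
  · subst h; simp
  · simp only [Matrix.of_apply, h, if_false]; split_ifs <;> ring

lemma Amat_row_zero (a : ℝ) (m : ℕ) (v : Fin (m+1) → ℝ) :
    ∑ j, GM.Amat a (m+1) 0 j * v j = v 0 := by
  simp [Amat_apply_split, sub_mul, Finset.sum_sub_distrib]

lemma Amat_row_succ (a : ℝ) (m : ℕ) (v : Fin (m+1) → ℝ) (i : Fin m) :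
    ∑ j, GM.Amat a (m+1) i.succ j * v j = v i.succ - a * v i.castSucc := by
  have h : ∀ j : Fin (m+1), ((i.succ : Fin (m+1)) : ℕ) = (j : ℕ) + 1 ↔ i.castSucc = j := by
    intro j; simp [Fin.ext_iff]
  simp only [Amat_apply_split, sub_mul, Finset.sum_sub_distrib, h]
  simp

lemma Amat_lower (a : ℝ) (ha0 : 0 ≤ a) (ha1 : a < 1) (n : ℕ) (v : Fin n → ℝ) :
    (1 - a) ^ 2 * ∑ i, v i ^ 2 ≤ ∑ i, ((GM.Amat a n *ᵥ v) i) ^ 2 := by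
  cases n with
  | zero => simp
  | succ m =>
    simp only [Matrix.mulVec, dotProduct]
    rw [Fin.sum_univ_succ (fun i => (∑ j, GM.Amat a (m+1) i j * v j) ^ 2)]
    simp only [Amat_row_zero, Amat_row_succ]
    have h1 : ∑ i : Fin m, ((1 - a) * v i.succ ^ 2 - a * (1 - a) * v i.castSucc ^ 2)
        ≤ ∑ i : Fin m, (v i.succ - a * v i.castSucc) ^ 2 := by
      refine Finset.sum_le_sum fun i _ => ?_
      nlinarith [mul_nonneg ha0 (sq_nonneg (v i.succ - v i.castSucc))]
    rw [Finset.sum_sub_distrib, ← Finset.mul_sum, ← Finset.mul_sum] at h1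
    have h2 := Fin.sum_univ_succ (fun i => v i ^ 2)
    have h3 := Fin.sum_univ_castSucc (fun i => v i ^ 2)
    have h4 : ∑ i : Fin m, v i.castSucc ^ 2 ≤ ∑ i, v i ^ 2 := by
      rw [h3]; nlinarith [sq_nonneg (v (Fin.last m))]
    have h5 : ∑ i : Fin m, v i.succ ^ 2 = ∑ i, v i ^ 2 - v 0 ^ 2 := by linarith
    rw [h5] at h1
    nlinarith [mul_le_mul_of_nonneg_left h4 (mul_nonneg ha0 (by linarith : 0 ≤ 1 - a)), mul_nonneg ha0 (sq_nonneg (v 0))]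

lemma eig_lower {a : ℝ} (ha0 : 0 ≤ a) (ha1 : a < 1) {n : ℕ} {μ : Fin n → ℝ}
    (h : GM.IsEigs μ ((GM.Amat a n)ᵀ * GM.Amat a n)) (i : Fin n) : (1 - a) ^ 2 ≤ μ i := by
  obtain ⟨-, P, h1, h2, h3⟩ := h
  have hD : Pᵀ * ((GM.Amat a n)ᵀ * GM.Amat a n) * P = Matrix.diagonal μ := by
    rw [h3]
    calc Pᵀ * (P * Matrix.diagonal μ * Pᵀ) * P = (Pᵀ * P) * Matrix.diagonal μ * (Pᵀ * P) := by
          simp only [Matrix.mul_assoc]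
      _ = _ := by rw [h2]; simp
  set v : Fin n → ℝ := fun k => P k i
  have hv : ∑ k, v k ^ 2 = 1 := by
    have := congrFun (congrFun h2 i) i
    simpa [Matrix.mul_apply, v, sq] using this
  have hA := Amat_lower a ha0 ha1 n v
  rw [hv] at hA
  have hE : ∑ k, ((GM.Amat a n *ᵥ v) k) ^ 2 = μ i := by
    have h4 := congrFun (congrFun hD i) i
    rw [Matrix.diagonal_apply_eq] at h4
    rw [← h4]
    have : Pᵀ * ((GM.Amat a n)ᵀ * GM.Amat a n) * P = (GM.Amat a n * P)ᵀ * (GM.Amat a n * P) := by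
      rw [Matrix.transpose_mul]; simp only [Matrix.mul_assoc]
    rw [this, Matrix.mul_apply]
    refine Finset.sum_congr rfl fun k _ => ?_
    simp [Matrix.mul_apply, Matrix.mulVec, dotProduct, v, sq]
  linarith

def Bmat (a : ℝ) (n : ℕ) : Matrix (Fin n) (Fin n) ℝ :=
  Matrix.of fun i j => if (j : ℕ) ≤ (i : ℕ) then a ^ ((i : ℕ) - (j : ℕ)) else 0

lemma AB (a : ℝ) (n : ℕ) : GM.Amat a n * Bmat a n = 1 := by
  cases n with
  | zero => ext i; exact i.elim0
  | succ m =>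
    ext i j
    rw [Matrix.mul_apply]
    refine Fin.cases ?_ (fun i => ?_) i
    · rw [Amat_row_zero a m (fun k => Bmat a (m+1) k j)]
      by_cases h : j = 0
      · subst h; simp [Bmat]
      · have : (0 : Fin (m+1)) ≠ j := fun h' => h h'.symm
        simp [Bmat, Matrix.one_apply, h, this]
    · rw [Amat_row_succ a m (fun k => Bmat a (m+1) k j)]
      simp only [Bmat, Matrix.of_apply, Matrix.one_apply, Fin.ext_iff, Fin.val_succ, Fin.val_castSucc]
      rcases lt_trichotomy (j : ℕ) ((i : ℕ) + 1) with h | h | h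
      · have e : (i : ℕ) + 1 - (j : ℕ) = ((i : ℕ) - (j : ℕ)) + 1 := by omega
        rw [if_pos (by omega), if_pos (by omega), if_neg (by omega), e, pow_succ]; ring
      · rw [if_pos (by omega), if_neg (by omega), if_pos (by omega), h]; simp
      · rw [if_neg (by omega), if_neg (by omega), if_neg (by omega)]; simp

lemma trace_inv {a : ℝ} {n : ℕ} {μ : Fin n → ℝ} (hμ : ∀ i, μ i ≠ 0)
    (h : GM.IsEigs μ ((GM.Amat a n)ᵀ * GM.Amat a n)) :
    ∑ i, (μ i)⁻¹ = ∑ i, ∑ j, Bmat a n i j ^ 2 := by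
  obtain ⟨-, P, h1, h2, h3⟩ := h
  have hBA : Bmat a n * GM.Amat a n = 1 := _root_.mul_eq_one_comm.mp (AB a n)
  have e1 : ((GM.Amat a n)ᵀ * GM.Amat a n) * (Bmat a n * (Bmat a n)ᵀ) = 1 := by
    calc _ = (GM.Amat a n)ᵀ * (GM.Amat a n * Bmat a n) * (Bmat a n)ᵀ := by simp only [Matrix.mul_assoc]
      _ = (Bmat a n * GM.Amat a n)ᵀ := by rw [AB, Matrix.transpose_mul]; simp
      _ = 1 := by rw [hBA]; simp
  have e2 : (P * Matrix.diagonal (fun i => (μ i)⁻¹) * Pᵀ) * ((GM.Amat a n)ᵀ * GM.Amat a n) = 1 := by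
    rw [h3]
    calc _ = P * (Matrix.diagonal (fun i => (μ i)⁻¹) * (Pᵀ * P) * Matrix.diagonal μ) * Pᵀ := by
          simp only [Matrix.mul_assoc]
      _ = P * (Matrix.diagonal (fun i => (μ i)⁻¹) * Matrix.diagonal μ) * Pᵀ := by rw [h2]; simp
      _ = 1 := by rw [Matrix.diagonal_mul_diagonal]; simp [hμ, h1]
  have e3 : P * Matrix.diagonal (fun i => (μ i)⁻¹) * Pᵀ = Bmat a n * (Bmat a n)ᵀ :=
    left_inv_eq_right_inv e2 e1
  have e4 := congrArg Matrix.trace e3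
  rw [Matrix.trace_mul_comm, ← Matrix.mul_assoc, h2, Matrix.one_mul, Matrix.trace_diagonal] at e4
  rw [e4]
  simp [Matrix.trace, Matrix.mul_apply, sq]

lemma row_sq (a : ℝ) (ha0 : 0 ≤ a) (ha1 : a < 1) (n : ℕ) (i : Fin n) :
    ∑ j, Bmat a n i j ^ 2 = (1 - (a ^ 2) ^ ((i : ℕ) + 1)) / (1 - a ^ 2) := by
  have hn : a ^ 2 < 1 := by nlinarith
  have h1 : ∑ j, Bmat a n i j ^ 2 = ∑ k ∈ Finset.range n, (if k ≤ (i:ℕ) then (a ^ 2) ^ ((i : ℕ) - k) else 0) := by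
    rw [← Fin.sum_univ_eq_sum_range (fun k => if k ≤ (i:ℕ) then (a ^ 2) ^ ((i : ℕ) - k) else 0) n]
    refine Finset.sum_congr rfl fun j _ => ?_
    simp only [Bmat, Matrix.of_apply]
    split_ifs
    · rw [← pow_mul, ← pow_mul, mul_comm]
    · simp
  rw [h1, ← Finset.sum_filter]
  have h2 : Finset.filter (fun k => k ≤ (i : ℕ)) (Finset.range n) = Finset.range ((i : ℕ) + 1) := by
    ext k; simp; omega
  rw [h2, ← Finset.sum_range_reflect (fun k => (a ^ 2) ^ ((i : ℕ) - k))]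
  rw [eq_div_iff (by linarith), ← geom_sum_mul_neg (a ^ 2) ((i : ℕ) + 1)]
  congr 1
  refine Finset.sum_congr rfl fun k hk => ?_
  rw [Finset.mem_range] at hk
  congr 1; omega

lemma trace_lower {a : ℝ} (ha0 : 0 ≤ a) (ha1 : a < 1) {n : ℕ} {μ : Fin n → ℝ}
    (h : GM.IsEigs μ ((GM.Amat a n)ᵀ * GM.Amat a n)) :
    n / (1 - a ^ 2) - 1 / (1 - a ^ 2) ^ 2 ≤ ∑ i, (μ i)⁻¹ := by
  have hn : a ^ 2 < 1 := by nlinarith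
  have hμ : ∀ i, μ i ≠ 0 := fun i => by
    have := eig_lower ha0 ha1 h i
    have : 0 < (1 - a) ^ 2 := by have : 0 < 1 - a := by linarith
                                 positivity
    linarith
  rw [trace_inv hμ h]
  simp only [row_sq a ha0 ha1]
  rw [Fin.sum_univ_eq_sum_range (fun i => (1 - (a ^ 2) ^ (i + 1)) / (1 - a ^ 2)) n, ← Finset.sum_div,
    Finset.sum_sub_distrib]
  have h3 : ∑ i ∈ Finset.range n, (a ^ 2) ^ (i + 1) ≤ 1 / (1 - a ^ 2) := by
    rw [le_div_iff₀ (by linarith)]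
    calc _ ≤ (∑ i ∈ Finset.range n, (a ^ 2) ^ i) * (1 - a ^ 2) := by
          refine mul_le_mul_of_nonneg_right (Finset.sum_le_sum fun i _ => ?_) (by linarith)
          exact pow_le_pow_of_le_one (by positivity) hn.le (by omega)
      _ = 1 - (a ^ 2) ^ n := geom_sum_mul_neg _ _
      _ ≤ 1 := by have : 0 ≤ (a ^ 2) ^ n := by positivity
                  linarith
  have h4 : (n:ℝ) / (1 - a ^ 2) - 1 / (1 - a ^ 2) ^ 2 = (n - 1 / (1 - a ^ 2)) / (1 - a ^ 2) := by
    have : (1 - a ^ 2) ≠ 0 := by linarith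
    rw [sub_div, div_div, sq (1 - a ^ 2)]
  rw [h4]
  have : 0 < 1 - a ^ 2 := by linarith
  gcongr
  simp

lemma gauss_mgf (m : ℝ) (v : ℝ≥0) (c : ℝ) :
    mgf (fun y => y - m) (gaussianReal m v) c = exp (v * c ^ 2 / 2) := by
  rw [mgf_gaussianReal (μ := 0) (v := v)]
  · simp
  · have := gaussianReal_map_sub_const (μ := m) (v := v) m
    simpa using this

lemma gauss_exp_int (m : ℝ) (v : ℝ≥0) (c : ℝ) :
    Integrable (fun y => exp (c * (y - m))) (gaussianReal m v) := by
  have h := (integrable_exp_mul_gaussianReal (μ := m) (v := v) c).mul_const (exp (-(c * m)))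
  refine h.congr (ae_of_all _ fun y => ?_)
  simp only [← exp_add]; congr 1; ring

lemma gauss_tail (m : ℝ) (v : ℝ≥0) (r : ℝ) :
    (gaussianReal m v).real {y | r ≤ |y - m|} ≤ 2 * exp (2 * v - 2 * r) := by
  have h1 := measure_ge_le_exp_mul_mgf (μ := gaussianReal m v) (X := fun y => y - m) (t := 2) r
    (by norm_num) (gauss_exp_int m v 2)
  have h2 := measure_le_le_exp_mul_mgf (μ := gaussianReal m v) (X := fun y => y - m) (t := -2) (-r)
    (by norm_num) (gauss_exp_int m v (-2))
  rw [gauss_mgf, ← exp_add] at h1 h2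
  have h3 : {y : ℝ | r ≤ |y - m|} ⊆ {y | r ≤ y - m} ∪ {y | y - m ≤ -r} := by
    intro y hy
    simp only [Set.mem_ofPred_eq, Set.mem_union, le_abs] at *
    rcases hy with h | h
    · left; exact h
    · right; linarith
  have h4 := (measureReal_mono (μ := gaussianReal m v) h3).trans (measureReal_union_le _ _)
  have e1 : -2 * r + (v:ℝ) * 2 ^ 2 / 2 = 2 * v - 2 * r := by ring
  have e2 : -(-2) * -r + (v:ℝ) * (-2) ^ 2 / 2 = 2 * v - 2 * r := by ring
  rw [e1] at h1; rw [e2] at h2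
  linarith

variable {n : ℕ}

lemma gauss_lin_tail (m : Fin n → ℝ) (v : Fin n → ℝ≥0) (c : Fin n → ℝ) (r : ℝ) :
    (Measure.pi fun i => gaussianReal (m i) (v i)).real {y | r ≤ ∑ i, c i * (y i - m i)}
      ≤ exp (-r + ∑ i, v i * c i ^ 2 / 2) := by
  set μ := Measure.pi fun i => gaussianReal (m i) (v i)
  have hind : iIndepFun (fun i (y : Fin n → ℝ) => c i * (y i - m i)) μ :=
    iIndepFun_pi (X := fun i y => c i * (y - m i)) (fun i => by fun_prop)
  have hsum : (fun y : Fin n → ℝ => ∑ i, c i * (y i - m i))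
      = ∑ i, (fun y : Fin n → ℝ => c i * (y i - m i)) := by ext; simp
  have hint1 : ∀ i, Integrable (fun y : Fin n → ℝ => exp (1 * (c i * (y i - m i)))) μ := by
    intro i
    have := (measurePreserving_eval (fun i => gaussianReal (m i) (v i)) i).integrable_comp_of_integrable
      (gauss_exp_int (m i) (v i) (c i))
    simpa [Function.comp_def] using this
  have hint : Integrable (fun y => exp (1 * (∑ i, (fun y : Fin n → ℝ => c i * (y i - m i))) y)) μ :=
    hind.integrable_exp_mul_sum (fun i => by fun_prop) (fun i _ => hint1 i)
  have h := measure_ge_le_exp_mul_mgf (μ := μ) r (by norm_num) hint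
  rw [hind.mgf_sum (fun i => by fun_prop)] at h
  have hm : ∀ i, mgf (fun y : Fin n → ℝ => c i * (y i - m i)) μ 1 = exp (v i * c i ^ 2 / 2) := by
    intro i
    rw [← gauss_mgf (m i)]
    unfold mgf
    have hp := measurePreserving_eval (fun i => gaussianReal (m i) (v i)) i
    rw [← hp.map_eq, integral_map (measurable_pi_apply i).aemeasurable (by fun_prop)]
    simp [μ]
  simp only [hm] at h
  rw [← exp_sum, ← exp_add] at h
  rw [← hsum] at h
  simpa using h

lemma pow4_le (u : ℝ) : u ^ 4 ≤ 24 * (exp u + exp (-u)) := by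
  have h1 : ∀ w : ℝ, 0 ≤ w → w ^ 4 ≤ 24 * exp w := by
    intro w hw
    have := pow_div_factorial_le_exp w hw 4
    norm_num [Nat.factorial] at this
    linarith
  rcases le_total 0 u with h | h
  · have := h1 u h
    have := exp_pos (-u)
    linarith
  · have := h1 (-u) (by linarith)
    have := exp_pos u
    have : (-u)^4 = u^4 := by ring
    linarith

lemma gauss_memLp (m : ℝ) (v : ℝ≥0) (x : ℝ) (p : ℝ≥0) :
    MemLp (fun y => x - y) p (gaussianReal m v) := by
  exact (memLp_const x).sub (memLp_id_gaussianReal p)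

lemma gauss_pow_int (m : ℝ) (v : ℝ≥0) (x : ℝ) (k : ℕ) :
    Integrable (fun y => (x - y) ^ k) (gaussianReal m v) := by
  have h := MemLp.integrable_norm_pow' (p := k) (by exact_mod_cast gauss_memLp m v x k)
  refine h.mono (by fun_prop) (ae_of_all _ fun y => by simp)

lemma gauss_sq_mean (m : ℝ) (v : ℝ≥0) (x : ℝ) :
    ∫ y, (x - y) ^ 2 ∂(gaussianReal m v) = (x - m) ^ 2 + v := by
  have h1 : Var[fun y => x - y; gaussianReal m v] = v := by
    have h := gaussianReal_map_const_sub (μ := m) (v := v) x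
    have h2 := variance_id_gaussianReal (μ := x - m) (v := v)
    rw [← h, variance_map (by fun_prop) (by fun_prop)] at h2
    exact h2
  rw [variance_eq_sub (by exact_mod_cast gauss_memLp m v x 2)] at h1
  have h3 : ∫ y, (x - y) ∂(gaussianReal m v) = x - m := by
    have i1 : Integrable (fun y : ℝ => y) (gaussianReal m v) := (memLp_id_gaussianReal (μ := m) (v := v) 1).integrable le_rfl
    rw [integral_sub (integrable_const x) i1]
    simp
  simp only [h3, Pi.pow_apply] at h1
  linarith

lemma gauss_fourth (m : ℝ) (v : ℝ≥0) (x : ℝ) :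
    ∫ y, (x - y) ^ 4 ∂(gaussianReal m v) ≤ 8 * (x - m) ^ 4 + 384 * exp (v / 2) := by
  have i1 := gauss_exp_int m v 1
  have i2 := gauss_exp_int m v (-1)
  have e1 := gauss_mgf m v 1
  have e2 := gauss_mgf m v (-1)
  unfold mgf at e1 e2
  calc ∫ y, (x - y) ^ 4 ∂(gaussianReal m v)
      ≤ ∫ y, (8 * (x - m) ^ 4 + 192 * (exp (1 * (y - m)) + exp (-1 * (y - m)))) ∂(gaussianReal m v) := by
        refine integral_mono (gauss_pow_int m v x 4) ?_ ?_
        · exact (integrable_const _).add ((i1.add i2).const_mul _)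
        · intro y
          have := pow4_le (y - m)
          have h2 : (x - y) ^ 4 ≤ 8 * (x - m) ^ 4 + 8 * (y - m) ^ 4 := by
            have e : x - y = (x - m) - (y - m) := by ring
            rw [e]
            generalize x - m = p
            generalize y - m = q
            nlinarith [sq_nonneg (p^2 - q^2), sq_nonneg (p + q), sq_nonneg ((p+q)^2), sq_nonneg (p - q), mul_nonneg (sq_nonneg (p+q)) (sq_nonneg p), mul_nonneg (sq_nonneg (p+q)) (sq_nonneg q), mul_nonneg (sq_nonneg (p+q)) (sq_nonneg (p-q))]
          simp only [one_mul, neg_mul]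
          linarith
    _ = 8 * (x - m) ^ 4 + 384 * exp (v / 2) := by
        rw [integral_add (by fun_prop) ((Integrable.fun_add i1 i2).const_mul _), integral_const_mul (192:ℝ), integral_add i1 i2, e1, e2]
        simp; ring

lemma cheb (m : Fin n → ℝ) (v : Fin n → ℝ≥0) (x a : Fin n → ℝ) (V r : ℝ) (hr : 0 < r)
    (ha : ∀ i, |a i| ≤ 1) (hV : ∀ i, 8 * (x i - m i) ^ 4 + 384 * exp (v i / 2) ≤ V) :
    (Measure.pi fun i => gaussianReal (m i) (v i)).real
      {y | r ≤ |∑ i, a i * (x i - y i) ^ 2 - ∑ i, a i * ((x i - m i) ^ 2 + v i)|}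
      ≤ n * V / r ^ 2 := by
  set μ := Measure.pi fun i => gaussianReal (m i) (v i)
  have hL : ∀ i, MemLp (fun y => a i * (x i - y) ^ 2) 2 (gaussianReal (m i) (v i)) := by
    intro i
    rw [memLp_two_iff_integrable_sq (by fun_prop)]
    refine ((gauss_pow_int (m i) (v i) (x i) 4).const_mul (a i ^ 2)).congr (ae_of_all _ fun y => ?_)
    simp only; ring
  have hp := fun i => measurePreserving_eval (fun i => gaussianReal (m i) (v i)) i
  have hL' : ∀ i, MemLp (fun y : Fin n → ℝ => a i * (x i - y i) ^ 2) 2 μ := fun i =>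
    (hL i).comp_measurePreserving (hp i)
  have hsum : (fun y : Fin n → ℝ => ∑ i, a i * (x i - y i) ^ 2)
      = ∑ i, (fun y : Fin n → ℝ => a i * (x i - y i) ^ 2) := by ext; simp
  have hLs : MemLp (fun y : Fin n → ℝ => ∑ i, a i * (x i - y i) ^ 2) 2 μ :=
    memLp_finsetSum _ fun i _ => hL' i
  have hE : ∫ y, ∑ i, a i * (x i - y i) ^ 2 ∂μ = ∑ i, a i * ((x i - m i) ^ 2 + v i) := by
    rw [integral_finsetSum _ fun i _ => (hL' i).integrable one_le_two]
    refine Finset.sum_congr rfl fun i _ => ?_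
    rw [← gauss_sq_mean, ← (hp i).map_eq, integral_map (measurable_pi_apply i).aemeasurable (by fun_prop), ← integral_const_mul]
  have h := meas_ge_le_variance_div_sq hLs hr
  rw [hE, hsum] at h
  rw [variance_sum_pi (X := fun i y => a i * (x i - y) ^ 2) hL] at h
  have hV' : ∑ i, Var[fun y => a i * (x i - y) ^ 2; gaussianReal (m i) (v i)] ≤ n * V := by
    calc _ ≤ ∑ i : Fin n, V := by
          refine Finset.sum_le_sum fun i _ => ?_
          refine (variance_le_expectation_sq (by fun_prop)).trans ?_
          refine le_trans ?_ (hV i)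
          refine le_trans ?_ (gauss_fourth _ _ _)
          refine integral_mono_of_nonneg (ae_of_all _ fun y => by simp only [Pi.pow_apply]; positivity) (gauss_pow_int _ _ _ _) (ae_of_all _ fun y => ?_)
          simp only [Pi.pow_apply]
          have h1 : a i ^ 2 ≤ 1 := by rw [← sq_abs]; exact pow_le_one₀ (abs_nonneg _) (ha i)
          have h2 : 0 ≤ (x i - y) ^ 4 := by positivity
          nlinarith
      _ = n * V := by simp
  have h2 : (0:ℝ) ≤ n * V / r ^ 2 := by
    refine div_nonneg ((Finset.sum_nonneg fun i _ => variance_nonneg _ _).trans hV') (by positivity)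
  refine ENNReal.toReal_le_of_le_ofReal h2 ?_
  have h3 := h.trans (ENNReal.ofReal_le_ofReal (div_le_div_of_nonneg_right hV' (by positivity)))
  simpa [Finset.sum_apply] using h3


lemma pi_forget (μ μ' : Fin n → Measure ℝ) [∀ i, IsProbabilityMeasure (μ i)]
    [∀ i, IsProbabilityMeasure (μ' i)] (k : Fin n) (h : ∀ i, i ≠ k → μ i = μ' i)
    (f : Fin n → ℝ → ℝ) (hf : ∀ i, Measurable (f i)) (c : ℝ) :
    (Measure.pi μ).real {y | c < ∑ i ∈ Finset.univ.erase k, f i (y i)}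
      = (Measure.pi μ').real {y | c < ∑ i ∈ Finset.univ.erase k, f i (y i)} := by
  classical
  have key : ∀ (ρ : Fin n → Measure ℝ) [∀ i, IsProbabilityMeasure (ρ i)],
      (Measure.pi ρ) {y | c < ∑ i ∈ Finset.univ.erase k, f i (y i)}
      = Measure.pi (fun i => if i = k then Measure.dirac 0 else ρ i)
          {y | c < ∑ i ∈ Finset.univ.erase k, f i (y i)} := by
    intro ρ _
    let g : Fin n → ℝ → ℝ := fun i => if i = k then (fun _ => 0) else id
    have hg : ∀ i, Measurable (g i) := by
      intro i; by_cases hi : i = k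
      · simp only [g, hi, if_true]; fun_prop
      · simp only [g, hi, if_false]; fun_prop
    have hmap : ∀ i, (ρ i).map (g i) = if i = k then Measure.dirac 0 else ρ i := by
      intro i; by_cases hi : i = k
      · simp [g, hi]
      · simp [g, hi]
    have hsf : ∀ i, SigmaFinite ((ρ i).map (g i)) := fun i => by
      have := Measure.isProbabilityMeasure_map (μ := ρ i) (hg i).aemeasurable
      infer_instance
    have hpi := Measure.pi_map_pi (μ := ρ) (f := g) (fun i => (hg i).aemeasurable)
    simp only [hmap] at hpi
    rw [← hpi, Measure.map_apply (by fun_prop) (measurableSet_lt (by fun_prop) (by fun_prop))]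
    congr 1
    ext y
    have : ∑ i ∈ Finset.univ.erase k, f i (g i (y i)) = ∑ i ∈ Finset.univ.erase k, f i (y i) := by
      refine Finset.sum_congr rfl fun i hi => ?_
      simp [g, Finset.ne_of_mem_erase hi]
    simp only [Set.mem_preimage, Set.mem_ofPred_eq, this]
  rw [measureReal_def, measureReal_def, key μ, key μ']
  have : (fun i => if i = k then Measure.dirac (0:ℝ) else μ i) = fun i => if i = k then Measure.dirac 0 else μ' i := by
    ext1 i
    by_cases hi : i = k
    · simp [hi]
    · simp [hi, h i hi]
  rw [this]

lemma step (μ μ' : Fin n → Measure ℝ) [∀ i, IsProbabilityMeasure (μ i)]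
    [∀ i, IsProbabilityMeasure (μ' i)] (k : Fin n) (h : ∀ i, i ≠ k → μ i = μ' i)
    (x : Fin n → ℝ) (N τ p : ℝ) (hp : (μ k).real {y | τ < (x k - y) ^ 2} ≤ p) :
    (Measure.pi μ).real {y | N < ∑ i, (x i - y i) ^ 2}
      - (Measure.pi μ').real {y | N < ∑ i, (x i - y i) ^ 2} - p
      ≤ (Measure.pi μ').real {y | N - τ < ∑ i, (x i - y i) ^ 2 ∧ ∑ i, (x i - y i) ^ 2 ≤ N} := by
  classical
  have hR := pi_forget μ μ' k h (fun i y => (x i - y) ^ 2) (fun i => by fun_prop) (N - τ)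
  have hs : ∀ y : Fin n → ℝ, ∑ i, (x i - y i) ^ 2
      = (x k - y k) ^ 2 + ∑ i ∈ Finset.univ.erase k, (x i - y i) ^ 2 := fun y =>
    (Finset.add_sum_erase _ _ (Finset.mem_univ k)).symm
  have h1 : (Measure.pi μ).real {y | N < ∑ i, (x i - y i) ^ 2} ≤
      (Measure.pi μ).real {y | N - τ < ∑ i ∈ Finset.univ.erase k, (x i - y i) ^ 2}
      + (Measure.pi μ).real {y | τ < (x k - y k) ^ 2} := by
    refine (measureReal_mono ?_).trans (measureReal_union_le _ _)
    intro y hy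
    simp only [Set.mem_union, Set.mem_ofPred_eq] at *
    rw [hs] at hy
    by_contra hc
    push Not at hc
    linarith [hc.1, hc.2]
  have h2 : (Measure.pi μ).real {y | τ < (x k - y k) ^ 2} = (μ k).real {y | τ < (x k - y) ^ 2} := by
    have := (measurePreserving_eval μ k).measureReal_preimage (s := {y | τ < (x k - y) ^ 2})
      (measurableSet_lt (by fun_prop) (by fun_prop)).nullMeasurableSet
    exact this
  have h3 : (Measure.pi μ').real {y | N - τ < ∑ i ∈ Finset.univ.erase k, (x i - y i) ^ 2}
      ≤ (Measure.pi μ').real {y | N < ∑ i, (x i - y i) ^ 2}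
      + (Measure.pi μ').real {y | N - τ < ∑ i, (x i - y i) ^ 2 ∧ ∑ i, (x i - y i) ^ 2 ≤ N} := by
    refine (measureReal_mono ?_).trans (measureReal_union_le _ _)
    intro y hy
    simp only [Set.mem_union, Set.mem_ofPred_eq] at *
    rw [hs]
    have := sq_nonneg (x k - y k)
    by_cases hc : N < (x k - y k) ^ 2 + ∑ i ∈ Finset.univ.erase k, (x i - y i) ^ 2
    · left; exact hc
    · right; constructor <;> linarith
  linarith

lemma cross (hn : 0 < n) (μ0 μ1 : Fin n → Measure ℝ) [∀ i, IsProbabilityMeasure (μ0 i)]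
    [∀ i, IsProbabilityMeasure (μ1 i)] (x : Fin n → ℝ) (N τ : ℝ)
    (hp : ∀ i, (μ0 i).real {y | τ < (x i - y) ^ 2} ≤ 1 / (4 * n))
    (h0 : 3 / 4 ≤ (Measure.pi μ0).real {y | N < ∑ i, (x i - y i) ^ 2})
    (h1 : (Measure.pi μ1).real {y | N < ∑ i, (x i - y i) ^ 2} ≤ 1 / 4) :
    ∃ b : Fin n → Bool, 1 / (4 * n) ≤ (Measure.pi fun i => if b i then μ1 i else μ0 i).real
      {y | N - τ < ∑ i, (x i - y i) ^ 2 ∧ ∑ i, (x i - y i) ^ 2 ≤ N} := by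
  classical
  let H : ℕ → Fin n → Measure ℝ := fun k i => if (decide ((i : ℕ) < k) : Bool) then μ1 i else μ0 i
  have hH : ∀ k i, IsProbabilityMeasure (H k i) := by
    intro k i; simp only [H]; split_ifs <;> infer_instance
  let f : ℕ → ℝ := fun k => (Measure.pi (H k)).real {y | N < ∑ i, (x i - y i) ^ 2}
  have f0 : 3 / 4 ≤ f 0 := by
    have : H 0 = μ0 := by ext1 i; simp [H]
    simp only [f, this]; exact h0
  have fn : f n ≤ 1 / 4 := by
    have : H n = μ1 := by ext1 i; simp [H]
    simp only [f, this]; exact h1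
  have hn' : (0:ℝ) < n := by exact_mod_cast hn
  have hex : ∃ k ∈ Finset.range n, 1 / (2 * (n:ℝ)) ≤ f k - f (k + 1) := by
    by_contra hc
    push Not at hc
    have := Finset.sum_lt_sum_of_nonempty (s := Finset.range n) ⟨0, Finset.mem_range.2 hn⟩ hc
    rw [Finset.sum_range_sub'] at this
    simp only [Finset.sum_const, Finset.card_range, nsmul_eq_mul] at this
    have e : (n:ℝ) * (1 / (2 * n)) = 1 / 2 := by field_simp
    linarith
  obtain ⟨k, hk, hfk⟩ := hex
  rw [Finset.mem_range] at hk
  refine ⟨fun i => decide ((i : ℕ) < k + 1), ?_⟩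
  have hs := step (H k) (H (k + 1)) ⟨k, hk⟩ (fun i hi => by
    have : (i : ℕ) ≠ k := fun h => hi (Fin.ext h)
    have h2 : ((i : ℕ) < k + 1) ↔ ((i : ℕ) < k) := by omega
    simp only [H, h2]) x N τ (1 / (4 * n)) (by
      have : H k ⟨k, hk⟩ = μ0 ⟨k, hk⟩ := by simp [H]
      rw [this]; exact hp _)
  refine le_trans ?_ hs
  have e : 1 / (2 * (n:ℝ)) = 1 / (4 * n) + 1 / (4 * n) := by field_simp; norm_num
  simp only [f] at hfk
  linarith

lemma pi_withDensity (μ : Fin n → Measure ℝ) [∀ i, IsProbabilityMeasure (μ i)]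
    (f : Fin n → ℝ → ℝ≥0∞) (hf : ∀ i, Measurable (f i)) (ν : Fin n → Measure ℝ)
    [∀ i, IsProbabilityMeasure (ν i)] (h : ∀ i, ν i = (μ i).withDensity (f i)) :
    Measure.pi ν = (Measure.pi μ).withDensity (fun y => ∏ i, f i (y i)) := by
  refine Measure.pi_eq fun s hs => ?_
  rw [withDensity_apply _ (MeasurableSet.univ_pi hs), ← lintegral_indicator (MeasurableSet.univ_pi hs)]
  have e : ∀ y : Fin n → ℝ, (Set.univ.pi s).indicator (fun y => ∏ i, f i (y i)) y
      = ∏ i, (s i).indicator (f i) (y i) := by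
    intro y
    by_cases hy : y ∈ Set.univ.pi s
    · rw [Set.indicator_of_mem hy]
      refine Finset.prod_congr rfl fun i _ => ?_
      rw [Set.indicator_of_mem (hy i (Set.mem_univ i))]
    · rw [Set.indicator_of_notMem hy]
      simp only [Set.mem_univ_pi, not_forall] at hy
      obtain ⟨i, hi⟩ := hy
      exact (Finset.prod_eq_zero (Finset.mem_univ i) (Set.indicator_of_notMem hi _)).symm
  simp_rw [e]
  have hm : ∀ i, Measurable ((s i).indicator (f i)) := fun i => (hf i).indicator (hs i)
  have hind : iIndepFun (fun i (y : Fin n → ℝ) => (s i).indicator (f i) (y i)) (Measure.pi μ) :=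
    iIndepFun_pi (X := fun i => (s i).indicator (f i)) (fun i => (hm i).aemeasurable)
  have := lintegral_prod_eq_prod_lintegral_of_indepFun Finset.univ
    (fun i (y : Fin n → ℝ) => (s i).indicator (f i) (y i)) hind
    (fun i => (hm i).comp (measurable_pi_apply i))
  rw [this]
  refine Finset.prod_congr rfl fun i _ => ?_
  rw [h i, withDensity_apply _ (hs i), ← lintegral_indicator (hs i)]
  exact (measurePreserving_eval μ i).lintegral_comp (hm i)

lemma gauss_wd (θ : ℝ) (hθ : 0 < θ) (w v : ℝ≥0) (hv : (v : ℝ) = θ * (w / (w + θ))) (p : ℝ) :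
    gaussianReal 0 w = (gaussianReal (w / (w + θ) * p) v).withDensity
      (fun y => ENNReal.ofReal (exp ((1 / 2) * log (θ / (w + θ)) +
        (y ^ 2 - 2 * p * y + w / (w + θ) * p ^ 2) / (2 * θ)))) := by
  by_cases hw : w = 0
  · have : v = 0 := by
      rw [hw] at hv; simp at hv; exact hv
    subst hw this
    simp only [gaussianReal_zero_var, NNReal.coe_zero, zero_div, zero_mul, zero_add]
    ext s hs
    rw [withDensity_apply _ hs, ← lintegral_indicator hs, lintegral_dirac' _ (by
      exact Measurable.indicator (by fun_prop) hs)]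
    simp [Set.indicator, div_self hθ.ne', Measure.dirac_apply' _ hs]
  · have hw' : (0:ℝ) < w := by positivity
    have hv0 : v ≠ 0 := by
      intro h; rw [h] at hv
      have : (0:ℝ) < θ * (w / (w + θ)) := by positivity
      simp at hv; rcases hv with h | h | h <;> linarith
    rw [gaussianReal_of_var_ne_zero _ hw, gaussianReal_of_var_ne_zero _ hv0,
      ← withDensity_mul _ (by fun_prop) (by fun_prop)]
    congr 1
    ext1 y
    simp only [Pi.mul_apply, gaussianPDF]
    rw [← ENNReal.ofReal_mul (gaussianPDFReal_nonneg _ _ _)]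
    congr 1
    simp only [gaussianPDFReal]
    have hq : (0:ℝ) < θ / (w + θ) := by positivity
    have e1 : exp ((1 / 2) * log (θ / (w + θ))) = √(θ / (w + θ)) := by
      rw [mul_comm, Real.exp_mul, Real.exp_log hq, Real.sqrt_eq_rpow]
    have hv' : 2 * π * (v:ℝ) = 2 * π * w * (θ / (w + θ)) := by rw [hv]; ring
    have e4 : √(2 * π * w * (θ / (w + θ))) = √(2 * π * w) * √(θ / (w + θ)) := Real.sqrt_mul (by positivity) _
    rw [exp_add, e1, hv', e4, mul_inv]
    have e2 : √(θ / (w + θ)) ≠ 0 := (Real.sqrt_pos.2 hq).ne'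
    have e3 : exp (-(y - 0) ^ 2 / (2 * w)) = exp (-(y - w / (w + θ) * p) ^ 2 / (2 * v))
        * exp ((y ^ 2 - 2 * p * y + w / (w + θ) * p ^ 2) / (2 * θ)) := by
      rw [← exp_add]; congr 1; rw [hv]; field_simp; ring
    rw [e3]
    generalize √(θ / (w + θ)) = q at *
    generalize √(2 * π * w) = q' at *
    field_simp

lemma coord_id (θ s x y t : ℝ) (hθ : 0 < θ) (hs : 0 < s) (w : ℝ) (hw : w = max (s - θ) 0) :
    (1 / 2) * log (θ / (w + θ)) + (y ^ 2 - 2 * ((1 + t) * x) * y + w / (w + θ) * ((1 + t) * x) ^ 2) / (2 * θ)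
    = - ((min θ s / (2 * θ)) * (x ^ 2 / s - 1) + (1 / 2) * log (max θ s / θ)) - min θ s / (2 * θ)
      + ((x - y) ^ 2 - (2 * t * x * (y - w / (w + θ) * ((1 + t) * x)) + t ^ 2 * (w / (w + θ)) * x ^ 2)) / (2 * θ) := by
  rcases le_total s θ with h | h
  · have : w = 0 := by rw [hw]; exact max_eq_right (by linarith)
    subst this
    rw [min_eq_right h, max_eq_left h]
    simp only [zero_add, div_self hθ.ne', log_one, zero_div]
    field_simp
    ring
  · have : w = s - θ := by rw [hw]; exact max_eq_left (by linarith)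
    subst this
    rw [min_eq_left h, max_eq_right h]
    simp only [sub_add_cancel]
    rw [show θ / s = (s / θ)⁻¹ by rw [inv_div], log_inv]
    field_simp
    ring

lemma change (θ : ℝ) (hθ : 0 < θ) (s x t : Fin n → ℝ) (hs : ∀ i, 0 < s i) (v : Fin n → ℝ≥0)
    (b : Fin n → ℝ) (hb : ∀ i, b i = (s i - θ).toNNReal / ((s i - θ).toNNReal + θ))
    (hv : ∀ i, (v i : ℝ) = θ * b i) (N τ r : ℝ) (hN : N = ∑ i, min θ (s i)) :
    exp (- GM.Jtilt θ s x - (τ + r) / (2 * θ)) *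
      (Measure.pi fun i => gaussianReal (b i * ((1 + t i) * x i)) (v i)).real
        ({y | N - τ < ∑ i, (x i - y i) ^ 2 ∧ ∑ i, (x i - y i) ^ 2 ≤ N} ∩
          {y | ∑ i, (2 * t i * x i * (y i - b i * ((1 + t i) * x i)) + t i ^ 2 * b i * x i ^ 2) ≤ r})
    ≤ (Measure.pi fun i => gaussianReal 0 (s i - θ).toNNReal).real {y | ∑ i, (x i - y i) ^ 2 ≤ N} := by
  set G := ({y : Fin n → ℝ | N - τ < ∑ i, (x i - y i) ^ 2 ∧ ∑ i, (x i - y i) ^ 2 ≤ N} ∩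
          {y | ∑ i, (2 * t i * x i * (y i - b i * ((1 + t i) * x i)) + t i ^ 2 * b i * x i ^ 2) ≤ r}) with hG
  have hGm : MeasurableSet G := by
    have m1 : MeasurableSet {y : Fin n → ℝ | N - τ < ∑ i, (x i - y i) ^ 2} :=
      measurableSet_lt (by fun_prop) (by fun_prop)
    have m2 : MeasurableSet {y : Fin n → ℝ | ∑ i, (x i - y i) ^ 2 ≤ N} :=
      measurableSet_le (by fun_prop) (by fun_prop)
    exact (m1.inter m2).inter (measurableSet_le (by fun_prop) (by fun_prop))
  set H := (Measure.pi fun i => gaussianReal (b i * ((1 + t i) * x i)) (v i)) with hH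
  have hwd := pi_withDensity (fun i => gaussianReal (b i * ((1 + t i) * x i)) (v i))
    (fun i y => ENNReal.ofReal (exp ((1 / 2) * log (θ / ((s i - θ).toNNReal + θ)) +
        (y ^ 2 - 2 * ((1 + t i) * x i) * y + b i * ((1 + t i) * x i) ^ 2) / (2 * θ))))
    (fun i => by fun_prop) (fun i => gaussianReal 0 (s i - θ).toNNReal) (fun i => by
      have := gauss_wd θ hθ (s i - θ).toNNReal (v i) (by rw [hv, hb]) ((1 + t i) * x i)
      rw [← hb] at this
      exact this)
  refine le_trans ?_ (measureReal_mono (s₁ := G) (fun y hy => hy.1.2))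
  rw [measureReal_def, measureReal_def, hwd, withDensity_apply _ hGm]
  rw [← ENNReal.toReal_ofReal (exp_pos (- GM.Jtilt θ s x - (τ + r) / (2 * θ))).le, ← ENNReal.toReal_mul]
  refine ENNReal.toReal_mono ?_ ?_
  · rw [← withDensity_apply _ hGm, ← hwd]; exact measure_ne_top _ _
  · rw [← setLIntegral_const]
    refine setLIntegral_mono' hGm fun y hy => ?_
    rw [← ENNReal.ofReal_prod_of_nonneg (fun i _ => (exp_pos _).le), ← exp_sum]
    refine ENNReal.ofReal_le_ofReal (exp_le_exp.2 ?_)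
    have e : ∀ i, _ := fun i => coord_id θ (s i) (x i) (y i) (t i) hθ (hs i) ((s i - θ).toNNReal) (Real.coe_toNNReal' _)
    simp only [← hb] at e
    simp only [e]
    rw [Finset.sum_add_distrib, Finset.sum_sub_distrib, Finset.sum_neg_distrib, ← Finset.sum_div, ← Finset.sum_div, ← hN,
      Finset.sum_sub_distrib]
    obtain ⟨⟨h1, h2⟩, h3⟩ := hy
    have h3' : ∑ i, (2 * t i * x i * (y i - b i * ((1 + t i) * x i)) + t i ^ 2 * b i * x i ^ 2) ≤ r := h3
    have h1' : N - τ < ∑ i, (x i - y i) ^ 2 := h1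
    simp only [GM.Jtilt]
    have : -(τ + r) / (2 * θ) ≤ -(N / (2 * θ)) + (∑ i, (x i - y i) ^ 2 - ∑ i, (2 * t i * x i * (y i - b i * ((1 + t i) * x i)) + t i ^ 2 * b i * x i ^ 2)) / (2 * θ) := by
      rw [← neg_div, ← add_div]
      exact div_le_div_of_nonneg_right (by linarith) (by positivity)
    rw [neg_div] at this
    linarith
end GMP

namespace GMP
variable {n : ℕ}

set_option maxHeartbeats 1000000 in
lemma typical_lower (hn : 0 < n) (θ S c ℓ : ℝ) (hθ : 0 < θ) (hθS : θ ≤ S) (hc : 0 < c) (hℓ : 1 ≤ ℓ)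
    (s x b : Fin n → ℝ) (hs : ∀ i, 0 < s i)
    (hb : ∀ i, b i = (s i - θ).toNNReal / ((s i - θ).toNNReal + θ))
    (N : ℝ) (hN : N = ∑ i, min θ (s i))
    (T4 : ∀ i, |x i| ≤ ℓ)
    (T1 : |∑ i, ((1 - b i) ^ 2 * x i ^ 2 + θ * b i) - N| ≤ ℓ * √n)
    (T2 : c * n ≤ ∑ i, b i * (1 - b i) * x i ^ 2)
    (L1 : ℓ ^ 8 ≤ √n) (L2 : ℓ + 1 ≤ c * ℓ ^ 3)
    (L3 : (128 + 384 * exp (S / 2)) / (c ^ 2 * ℓ ^ 2) ≤ 1 / 4)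
    (L4 : 2 * exp (2 * S - 4 * ℓ) ≤ 1 / (4 * n)) (L5 : exp (-2 * ℓ) ≤ 1 / (8 * n)) :
    exp (- GM.Jtilt θ s x - (16 * ℓ ^ 2 + (2 * S * ℓ ^ 8 + 2 * ℓ + ℓ ^ 8)) / (2 * θ)) * (1 / (8 * n)) ≤
      (Measure.pi fun i => gaussianReal 0 (s i - θ).toNNReal).real {y | ∑ i, (x i - y i) ^ 2 ≤ N} := by
  have hn' : (0:ℝ) < n := by exact_mod_cast hn
  have hq : 0 < √(n:ℝ) := Real.sqrt_pos.2 hn'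
  have hqq : √(n:ℝ) ^ 2 = n := Real.sq_sqrt hn'.le
  have hℓ0 : 0 < ℓ := by linarith
  have hb0 : ∀ i, 0 ≤ b i := fun i => by rw [hb]; positivity
  have hb1 : ∀ i, b i ≤ 1 := fun i => by
    rw [hb, div_le_one (by positivity)]; linarith
  set T : ℝ := ℓ ^ 3 / √n with hT
  have hT0 : 0 ≤ T := by positivity
  have hT1 : T ≤ 1 := by
    rw [hT, div_le_one hq]
    exact (pow_le_pow_right₀ hℓ (by norm_num)).trans L1
  have hTT : T ^ 2 * n = ℓ ^ 6 := by
    rw [hT, div_pow, hqq]; field_simp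
  have hTq : T * n = ℓ ^ 3 * √n := by
    rw [hT]; nth_rewrite 2 [← hqq]; field_simp
  let v : Fin n → ℝ≥0 := fun i => ⟨θ * b i, mul_nonneg hθ.le (hb0 i)⟩
  have hv : ∀ i, (v i : ℝ) = θ * b i := fun i => rfl
  have hvS : ∀ i, (v i : ℝ) ≤ S := fun i => by
    rw [hv]; nlinarith [hb0 i, hb1 i]
  have hx2 : ∀ i, x i ^ 2 ≤ ℓ ^ 2 := fun i => by
    rw [← sq_abs]; exact pow_le_pow_left₀ (abs_nonneg _) (T4 i) 2
  -- distance to the mean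
  have hmean : ∀ t : ℝ, |t| ≤ 1 → ∀ i, |x i - b i * ((1 + t) * x i)| ≤ 2 * ℓ := by
    intro t ht i
    have e : x i - b i * ((1 + t) * x i) = (1 - (1 + t) * b i) * x i := by ring
    rw [e, abs_mul]
    rw [abs_le] at ht
    have : |1 - (1 + t) * b i| ≤ 2 := by
      rw [abs_le]
      constructor <;> nlinarith [hb0 i, hb1 i, ht.1, ht.2]
    exact mul_le_mul this (T4 i) (abs_nonneg _) (by norm_num)
  have hV : ∀ t : ℝ, |t| ≤ 1 → ∀ i, 8 * (x i - b i * ((1 + t) * x i)) ^ 4 + 384 * exp (v i / 2)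
      ≤ (128 + 384 * exp (S / 2)) * ℓ ^ 4 := by
    intro t ht i
    have h1 : (x i - b i * ((1 + t) * x i)) ^ 4 ≤ (2 * ℓ) ^ 4 := by
      rw [← Even.pow_abs (by decide : Even 4)]
      exact pow_le_pow_left₀ (abs_nonneg _) (hmean t ht i) 4
    have h2 : exp ((v i : ℝ) / 2) ≤ exp (S / 2) := exp_le_exp.2 (by linarith [hvS i])
    have h3 : 1 ≤ ℓ ^ 4 := one_le_pow₀ hℓ
    have h4 := exp_pos (S / 2)
    nlinarith
  have hch : ∀ t : ℝ, |t| ≤ 1 → (Measure.pi fun i => gaussianReal (b i * ((1 + t) * x i)) (v i)).real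
      {y | c * ℓ ^ 3 * √n ≤ |∑ i, (1:ℝ) * (x i - y i) ^ 2 - ∑ i, (1:ℝ) * ((x i - b i * ((1 + t) * x i)) ^ 2 + v i)|} ≤ 1 / 4 := by
    intro t ht
    refine (cheb _ v x (fun _ => 1) _ (c * ℓ ^ 3 * √n) (by positivity) (by simp) (hV t ht)).trans ?_
    refine le_trans (le_of_eq ?_) L3
    rw [mul_pow, hqq]; field_simp
  simp only [one_mul] at hch
  have hM : ∀ t : ℝ, ∑ i, ((x i - b i * ((1 + t) * x i)) ^ 2 + (v i : ℝ))
      = ∑ i, ((1 - b i) ^ 2 * x i ^ 2 + θ * b i) - 2 * t * ∑ i, b i * (1 - b i) * x i ^ 2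
        + t ^ 2 * ∑ i, b i ^ 2 * x i ^ 2 := by
    intro t
    rw [Finset.mul_sum, Finset.mul_sum, ← Finset.sum_sub_distrib, ← Finset.sum_add_distrib]
    refine Finset.sum_congr rfl fun i _ => ?_
    rw [hv]; ring
  have hB2 : ∑ i, b i ^ 2 * x i ^ 2 ≤ n * ℓ ^ 2 := by
    calc _ ≤ ∑ i : Fin n, ℓ ^ 2 := by
          refine Finset.sum_le_sum fun i _ => ?_
          have : b i ^ 2 ≤ 1 := pow_le_one₀ (hb0 i) (hb1 i)
          nlinarith [hx2 i, sq_nonneg (x i)]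
      _ = _ := by simp
  have hB2' : 0 ≤ ∑ i, b i ^ 2 * x i ^ 2 := Finset.sum_nonneg fun i _ => by positivity
  have hTB : T ^ 2 * ∑ i, b i ^ 2 * x i ^ 2 ≤ ℓ ^ 8 := by
    calc _ ≤ T ^ 2 * (n * ℓ ^ 2) := by gcongr
      _ = ℓ ^ 8 := by rw [← mul_assoc, hTT]; ring
  have hTQ : c * ℓ ^ 3 * √n ≤ T * ∑ i, b i * (1 - b i) * x i ^ 2 := by
    calc _ = T * (c * n) := by rw [mul_left_comm, hTq]; ring
      _ ≤ _ := by gcongr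
  have L2' : ℓ * √n + ℓ ^ 8 ≤ c * ℓ ^ 3 * √n := by nlinarith
  rw [abs_le] at T1
  have hT1' : |T| ≤ 1 := by rw [abs_of_nonneg hT0]; exact hT1
  have hT1'' : |-T| ≤ 1 := by rw [abs_neg]; exact hT1'
  -- the two ends
  have h0 : 3 / 4 ≤ (Measure.pi fun i => gaussianReal (b i * ((1 + -T) * x i)) (v i)).real
      {y | N < ∑ i, (x i - y i) ^ 2} := by
    have h := hch (-T) hT1''
    rw [hM] at h
    have hm : MeasurableSet {y : Fin n → ℝ | N < ∑ i, (x i - y i) ^ 2} :=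
      measurableSet_lt (by fun_prop) (by fun_prop)
    have h2 := probReal_compl_eq_one_sub (μ := Measure.pi fun i => gaussianReal (b i * ((1 + -T) * x i)) (v i)) hm
    have h3 : (Measure.pi fun i => gaussianReal (b i * ((1 + -T) * x i)) (v i)).real
        {y : Fin n → ℝ | N < ∑ i, (x i - y i) ^ 2}ᶜ ≤ 1 / 4 := by
      refine (measureReal_mono ?_).trans h
      intro y hy
      simp only [Set.mem_compl_iff, Set.mem_ofPred_eq, not_lt] at *
      rw [abs_sub_comm]
      refine le_trans ?_ (le_abs_self _)
      have : 0 ≤ (-T) ^ 2 * ∑ i, b i ^ 2 * x i ^ 2 := by positivity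
      have h8 : 0 ≤ ℓ ^ 8 := by positivity
      linarith [T1.1]
    linarith
  have h1 : (Measure.pi fun i => gaussianReal (b i * ((1 + T) * x i)) (v i)).real
      {y | N < ∑ i, (x i - y i) ^ 2} ≤ 1 / 4 := by
    have h := hch T hT1'
    rw [hM] at h
    refine (measureReal_mono ?_).trans h
    intro y hy
    simp only [Set.mem_ofPred_eq] at *
    refine le_trans ?_ (le_abs_self _)
    linarith [T1.2]
  obtain ⟨β, hβ⟩ := cross hn (fun i => gaussianReal (b i * ((1 + -T) * x i)) (v i))
    (fun i => gaussianReal (b i * ((1 + T) * x i)) (v i)) x N (16 * ℓ ^ 2) (by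
      intro i
      refine le_trans ?_ L4
      have h := gauss_tail (b i * ((1 + -T) * x i)) (v i) (2 * ℓ)
      have h2 : 2 * exp (2 * (v i : ℝ) - 2 * (2 * ℓ)) ≤ 2 * exp (2 * S - 4 * ℓ) := by
        have := hvS i
        gcongr ?_ * exp ?_
        linarith
      refine le_trans (measureReal_mono ?_) (h.trans h2)
      intro y hy
      simp only [Set.mem_ofPred_eq] at *
      have h3 := hmean (-T) hT1'' i
      have h4 : 4 * ℓ < |x i - y| := by
        rw [← sq_abs (x i - y)] at hy
        by_contra hcc
        push Not at hcc
        have hp := pow_le_pow_left₀ (abs_nonneg _) hcc 2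
        have e : (4 * ℓ) ^ 2 = 16 * ℓ ^ 2 := by ring
        linarith
      have h5 : |x i - y| ≤ |x i - b i * ((1 + -T) * x i)| + |y - b i * ((1 + -T) * x i)| := by
        rw [abs_sub_comm y]
        refine le_trans (le_of_eq ?_) (abs_add_le _ _)
        congr 1; ring
      linarith) h0 h1
  set t : Fin n → ℝ := fun i => if β i then T else -T with ht
  have heq : (fun i => if β i then gaussianReal (b i * ((1 + T) * x i)) (v i) else gaussianReal (b i * ((1 + -T) * x i)) (v i))
      = fun i => gaussianReal (b i * ((1 + t i) * x i)) (v i) := by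
    ext1 i; simp only [ht]; split_ifs <;> rfl
  rw [heq] at hβ
  have ht2 : ∀ i, t i ^ 2 = T ^ 2 := fun i => by simp only [ht]; split_ifs <;> ring
  refine le_trans ?_ (change θ hθ s x t hs v b hb hv N (16 * ℓ ^ 2) (2 * S * ℓ ^ 8 + 2 * ℓ + ℓ ^ 8) hN)
  refine mul_le_mul_of_nonneg_left ?_ (exp_pos _).le
  set H := (Measure.pi fun i => gaussianReal (b i * ((1 + t i) * x i)) (v i)) with hH
  set W := {y : Fin n → ℝ | N - 16 * ℓ ^ 2 < ∑ i, (x i - y i) ^ 2 ∧ ∑ i, (x i - y i) ^ 2 ≤ N}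
  set E := {y : Fin n → ℝ | ∑ i, (2 * t i * x i * (y i - b i * ((1 + t i) * x i)) + t i ^ 2 * b i * x i ^ 2)
    ≤ 2 * S * ℓ ^ 8 + 2 * ℓ + ℓ ^ 8} with hE
  have hEc : H.real Eᶜ ≤ 1 / (8 * n) := by
    have h := gauss_lin_tail (fun i => b i * ((1 + t i) * x i)) v (fun i => 2 * t i * x i) (2 * S * ℓ ^ 8 + 2 * ℓ)
    have h2 : ∑ i, (v i : ℝ) * (2 * t i * x i) ^ 2 / 2 ≤ 2 * S * ℓ ^ 8 := by
      calc _ ≤ ∑ i : Fin n, 2 * S * T ^ 2 * ℓ ^ 2 := by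
            refine Finset.sum_le_sum fun i _ => ?_
            have e : (v i : ℝ) * (2 * t i * x i) ^ 2 / 2 = 2 * v i * T ^ 2 * x i ^ 2 := by
              rw [mul_pow, mul_pow, ht2]; ring
            rw [e]
            have := hvS i
            have := hx2 i
            have : 0 ≤ S := by linarith
            gcongr
        _ = 2 * S * (T ^ 2 * n) * ℓ ^ 2 := by simp; ring
        _ = _ := by rw [hTT]; ring
    have h3 : exp (-(2 * S * ℓ ^ 8 + 2 * ℓ) + ∑ i, (v i : ℝ) * (2 * t i * x i) ^ 2 / 2) ≤ exp (-2 * ℓ) :=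
      exp_le_exp.2 (by linarith)
    refine le_trans (measureReal_mono ?_) (h.trans (h3.trans L5))
    intro y hy
    simp only [hE, Set.mem_compl_iff, Set.mem_ofPred_eq, not_le] at *
    rw [Finset.sum_add_distrib] at hy
    have h4 : ∑ i, t i ^ 2 * b i * x i ^ 2 ≤ ℓ ^ 8 := by
      calc _ ≤ ∑ i : Fin n, T ^ 2 * ℓ ^ 2 := by
            refine Finset.sum_le_sum fun i _ => ?_
            rw [ht2]
            have h5 : T ^ 2 * b i ≤ T ^ 2 := by nlinarith [sq_nonneg T, hb1 i]
            have := hx2 i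
            gcongr
        _ = (T ^ 2 * n) * ℓ ^ 2 := by simp; ring
        _ = _ := by rw [hTT]; ring
    linarith
  have hW : H.real W ≤ H.real (W ∩ E) + H.real Eᶜ := by
    refine (measureReal_mono ?_).trans (measureReal_union_le _ _)
    intro y hy
    by_cases h : y ∈ E
    · left; exact ⟨hy, h⟩
    · right; exact h
  have e : 1 / (4 * (n:ℝ)) = 1 / (8 * n) + 1 / (8 * n) := by field_simp; norm_num
  linarith

lemma typical_prob (hn : 0 < n) (θ S c ℓ : ℝ) (hθ : 0 < θ) (hc : 0 < c)
    (hℓ : 1 ≤ ℓ) (s b : Fin n → ℝ) (hs : ∀ i, 0 < s i) (hsS : ∀ i, s i ≤ S)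
    (hb : ∀ i, b i = (s i - θ).toNNReal / ((s i - θ).toNNReal + θ))
    (N : ℝ) (hN : N = ∑ i, min θ (s i))
    (hcn : 2 * c * n ≤ ∑ i, b i * (1 - b i) * s i)
    (L1 : ℓ ^ 2 ≤ n) (L2 : n * exp (-2 * ℓ) ≤ 1 / ℓ ^ 2) :
    (Measure.pi fun i => gaussianReal 0 (s i).toNNReal).real
      {x | (∀ i, |x i| ≤ ℓ) ∧ |∑ i, ((1 - b i) ^ 2 * x i ^ 2 + θ * b i) - N| ≤ ℓ * √n ∧
        c * n ≤ ∑ i, b i * (1 - b i) * x i ^ 2}ᶜ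
      ≤ (384 * exp (S / 2) + 384 * exp (S / 2) / c ^ 2 + 2 * exp (2 * S)) / ℓ ^ 2 := by
  have hn' : (0:ℝ) < n := by exact_mod_cast hn
  have hq : 0 < √(n:ℝ) := Real.sqrt_pos.2 hn'
  have hqq : √(n:ℝ) ^ 2 = n := Real.sq_sqrt hn'.le
  have hℓ0 : 0 < ℓ := by linarith
  have hb0 : ∀ i, 0 ≤ b i := fun i => by rw [hb]; positivity
  have hb1 : ∀ i, b i ≤ 1 := fun i => by
    rw [hb, div_le_one (by positivity)]; linarith
  have hsv : ∀ i, ((s i).toNNReal : ℝ) = s i := fun i => Real.coe_toNNReal _ (hs i).le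
  set μ := Measure.pi fun i => gaussianReal 0 (s i).toNNReal with hμ
  have hV : ∀ i, 8 * ((0:ℝ) - 0) ^ 4 + 384 * exp ((s i).toNNReal / 2) ≤ 384 * exp (S / 2) := by
    intro i
    rw [hsv]
    have : exp (s i / 2) ≤ exp (S / 2) := exp_le_exp.2 (by linarith [hsS i])
    norm_num; linarith [hsS i]
  have hid : ∀ i, (1 - b i) ^ 2 * s i + θ * b i = min θ (s i) := by
    intro i
    rw [hb, Real.coe_toNNReal']
    have := hs i
    rcases le_total (s i) θ with h | h
    · rw [max_eq_right (by linarith), min_eq_right h]; simp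
    · rw [max_eq_left (by linarith), min_eq_left h]
      simp only [sub_add_cancel]; field_simp; ring
  have c1 := cheb (fun _ : Fin n => (0:ℝ)) (fun i => (s i).toNNReal) (fun _ => 0) (fun i => (1 - b i) ^ 2)
    (384 * exp (S / 2)) (ℓ * √n) (by positivity) (fun i => by
      rw [abs_of_nonneg (by positivity)]
      exact pow_le_one₀ (by linarith [hb1 i]) (by linarith [hb0 i])) hV
  have c2 := cheb (fun _ : Fin n => (0:ℝ)) (fun i => (s i).toNNReal) (fun _ => 0) (fun i => b i * (1 - b i))
    (384 * exp (S / 2)) (c * n) (by positivity) (fun i => by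
      rw [abs_of_nonneg (mul_nonneg (hb0 i) (by linarith [hb1 i]))]
      nlinarith [hb0 i, hb1 i]) hV
  have c3 : μ.real (⋃ i, {x : Fin n → ℝ | ℓ ≤ |x i - 0|}) ≤ 2 * exp (2 * S) / ℓ ^ 2 := by
    refine (measureReal_iUnion_fintype_le _).trans ?_
    calc _ ≤ ∑ i : Fin n, 2 * exp (2 * S) * exp (-2 * ℓ) := by
          refine Finset.sum_le_sum fun i _ => ?_
          have := (measurePreserving_eval (fun i => gaussianReal 0 (s i).toNNReal) i).measureReal_preimage
            (s := {y | ℓ ≤ |y - 0|}) (measurableSet_le (by fun_prop) (by fun_prop)).nullMeasurableSet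
          refine le_trans (le_of_eq this) ((gauss_tail _ _ _).trans ?_)
          rw [mul_assoc, ← exp_add, hsv]
          have := hsS i
          gcongr ?_ * exp ?_
          linarith
      _ = 2 * exp (2 * S) * (n * exp (-2 * ℓ)) := by simp; ring
      _ ≤ 2 * exp (2 * S) * (1 / ℓ ^ 2) := by gcongr
      _ = _ := by ring
  have d1 : (n:ℝ) * (384 * exp (S / 2)) / (ℓ * √n) ^ 2 = 384 * exp (S / 2) / ℓ ^ 2 := by
    rw [mul_pow, hqq]; field_simp
  have d2 : (n:ℝ) * (384 * exp (S / 2)) / (c * n) ^ 2 ≤ 384 * exp (S / 2) / c ^ 2 / ℓ ^ 2 := by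
    have : (n:ℝ) * (384 * exp (S / 2)) / (c * n) ^ 2 = 384 * exp (S / 2) / c ^ 2 / n := by field_simp
    rw [this]; gcongr
  rw [d1] at c1
  have c2' := c2.trans d2
  rw [add_div, add_div]
  refine le_trans ?_ (add_le_add (add_le_add c1 c2') c3)
  refine le_trans (measureReal_mono ?_) ((measureReal_union_le _ _).trans (add_le_add (measureReal_union_le _ _) le_rfl))
  intro x hx
  by_contra hc'
  simp only [Set.mem_union, Set.mem_iUnion, Set.mem_ofPred_eq, not_or, not_exists, not_le, hsv, sub_zero, zero_sub, neg_sq, ne_eq, OfNat.ofNat_ne_zero, not_false_eq_true, zero_pow, zero_add] at hc'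
  obtain ⟨⟨k1, k2⟩, k3⟩ := hc'
  refine hx ⟨fun i => (k3 i).le, ?_, ?_⟩
  · refine le_trans (le_of_eq ?_) k1.le
    congr 1
    rw [hN, ← Finset.sum_sub_distrib, ← Finset.sum_sub_distrib]
    refine Finset.sum_congr rfl fun i _ => ?_
    rw [← hid]; ring
  · rw [abs_lt] at k2
    linarith [k2.1]
end GMP

namespace GMP

lemma core {n : ℕ} (hn : 0 < n) (d θ S c D ℓ : ℝ) (hd : 0 < d) (hθ : 0 < θ) (hS : 0 < S) (hD : 0 < D)
    (hc : c = d * D / (4 * S)) (s : Fin n → ℝ) (hs : ∀ i, 0 < s i) (hsS : ∀ i, s i ≤ S)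
    (hdn : d = (1 / (n : ℝ)) * ∑ i, min θ (s i)) (htr : n * d + n * D / 2 ≤ ∑ i, s i) (hℓ : 1 ≤ ℓ)
    (L1 : ℓ ^ 8 ≤ √n) (L2 : ℓ + 1 ≤ c * ℓ ^ 3)
    (L3 : (128 + 384 * exp (S / 2)) / (c ^ 2 * ℓ ^ 2) ≤ 1 / 4)
    (L4 : 2 * exp (2 * S - 4 * ℓ) ≤ 1 / (4 * n)) (L5 : exp (-2 * ℓ) ≤ 1 / (8 * n))
    (M2 : n * exp (-2 * ℓ) ≤ 1 / ℓ ^ 2)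
    (M3 : (16 * ℓ ^ 2 + (2 * S * ℓ ^ 8 + 2 * ℓ + ℓ ^ 8)) / (2 * d) + log (8 * n) ≤ ℓ ^ 9) :
    1 - ENNReal.ofReal ((384 * exp (S / 2) + 384 * exp (S / 2) / c ^ 2 + 2 * exp (2 * S)) / ℓ ^ 2) ≤
      (Measure.pi fun i : Fin n => gaussianReal 0 (s i).toNNReal)
        {x | Real.log (1 / ((Measure.pi fun i : Fin n => gaussianReal 0 (s i - θ).toNNReal)
                {y | GM.distortion n x y ≤ d}).toReal) ≤ GM.Jtilt θ s x + ℓ ^ 9} := by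
  have hn' : (0:ℝ) < n := by exact_mod_cast hn
  have hqq : √(n:ℝ) ^ 2 = n := Real.sq_sqrt hn'.le
  have hc0 : 0 < c := by rw [hc]; positivity
  have hN : n * d = ∑ i, min θ (s i) := by rw [hdn]; field_simp
  have hdθ : d ≤ θ := by
    have h : ∑ i, min θ (s i) ≤ ∑ i : Fin n, θ := Finset.sum_le_sum fun i _ => min_le_left _ _
    simp only [Finset.sum_const, Finset.card_univ, Fintype.card_fin, nsmul_eq_mul] at h
    rw [← hN] at h
    exact le_of_mul_le_mul_left h hn'
  have hθS : θ ≤ S := by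
    by_contra h
    push Not at h
    have h1 : ∑ i, min θ (s i) = ∑ i, s i :=
      Finset.sum_congr rfl fun i _ => min_eq_right ((hsS i).trans h.le)
    have : 0 < n * D / 2 := by positivity
    linarith
  have M1 : ℓ ^ 2 ≤ n := by
    calc ℓ ^ 2 ≤ ℓ ^ 16 := pow_le_pow_right₀ hℓ (by norm_num)
      _ = (ℓ ^ 8) ^ 2 := by ring
      _ ≤ √n ^ 2 := pow_le_pow_left₀ (by positivity) L1 2
      _ = n := hqq
  set b : Fin n → ℝ := fun i => (s i - θ).toNNReal / ((s i - θ).toNNReal + θ) with hb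
  have hcn : 2 * c * n ≤ ∑ i, b i * (1 - b i) * s i := by
    have h1 : ∀ i, (s i - min θ (s i)) * (d / S) ≤ b i * (1 - b i) * s i := by
      intro i
      simp only [hb, Real.coe_toNNReal']
      have h0 := hs i
      rcases le_total (s i) θ with h | h
      · rw [max_eq_right (by linarith), min_eq_right h]; simp
      · rw [max_eq_left (by linarith), min_eq_left h]
        have e : (s i - θ) / (s i - θ + θ) * (1 - (s i - θ) / (s i - θ + θ)) * s i = (s i - θ) * (θ / s i) := by
          simp only [sub_add_cancel]; field_simp; ring
        rw [e]
        have h2 := hsS i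
        have h3 : 0 ≤ s i - θ := by linarith
        gcongr
    have h2 := Finset.sum_le_sum fun i (_ : i ∈ Finset.univ) => h1 i
    rw [← Finset.sum_mul, Finset.sum_sub_distrib, ← hN] at h2
    refine le_trans ?_ h2
    calc 2 * c * n = (n * D / 2) * (d / S) := by rw [hc]; field_simp; norm_num
      _ ≤ _ := by gcongr; linarith
  have tp := typical_prob hn θ S c ℓ hθ hc0 hℓ s b hs hsS (fun i => rfl) _ hN hcn M1 M2
  set μ := Measure.pi fun i => gaussianReal 0 (s i).toNNReal with hμ
  set T := {x : Fin n → ℝ | (∀ i, |x i| ≤ ℓ) ∧ |∑ i, ((1 - b i) ^ 2 * x i ^ 2 + θ * b i) - n * d| ≤ ℓ * √n ∧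
        c * n ≤ ∑ i, b i * (1 - b i) * x i ^ 2} with hT
  have hT1 : 1 - ENNReal.ofReal ((384 * exp (S / 2) + 384 * exp (S / 2) / c ^ 2 + 2 * exp (2 * S)) / ℓ ^ 2) ≤ μ T := by
    rw [tsub_le_iff_right]
    calc (1 : ℝ≥0∞) = μ Set.univ := measure_univ.symm
      _ = μ (T ∪ Tᶜ) := by rw [Set.union_compl_self]
      _ ≤ μ T + μ Tᶜ := measure_union_le _ _
      _ ≤ _ := by
        gcongr
        rw [← ofReal_measureReal]
        exact ENNReal.ofReal_le_ofReal tp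
  refine hT1.trans (measure_mono ?_)
  rintro x ⟨T4, T1, T2⟩
  have low := typical_lower hn θ S c ℓ hθ hθS hc0 hℓ s x b hs (fun i => rfl) _ hN T4 T1 T2 L1 L2 L3 L4 L5
  have hset : {y | GM.distortion n x y ≤ d} = {y : Fin n → ℝ | ∑ i, (x i - y i) ^ 2 ≤ n * d} := by
    ext y
    simp only [Set.mem_ofPred_eq, GM.distortion]
    rw [one_div, inv_mul_le_iff₀ hn']
  simp only [Set.mem_ofPred_eq]
  rw [hset]
  change Real.log (1 / (Measure.pi fun i : Fin n => gaussianReal 0 (s i - θ).toNNReal).real _) ≤ _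
  set p := (Measure.pi fun i : Fin n => gaussianReal 0 (s i - θ).toNNReal).real
    {y : Fin n → ℝ | ∑ i, (x i - y i) ^ 2 ≤ n * d}
  have h8 : (0:ℝ) < 1 / (8 * n) := by positivity
  have hl := Real.log_le_log (mul_pos (exp_pos _) h8) low
  rw [Real.log_mul (exp_pos _).ne' h8.ne', Real.log_exp, one_div, Real.log_inv] at hl
  rw [one_div, Real.log_inv]
  have hE : (16 * ℓ ^ 2 + (2 * S * ℓ ^ 8 + 2 * ℓ + ℓ ^ 8)) / (2 * θ) ≤
      (16 * ℓ ^ 2 + (2 * S * ℓ ^ 8 + 2 * ℓ + ℓ ^ 8)) / (2 * d) := by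
    gcongr
  linarith

lemma ev_real (c S d : ℝ) (hc : 0 < c) (hd : 0 < d) :
    ∀ᶠ ℓ : ℝ in atTop, 1 ≤ ℓ ∧ ℓ ^ 8 ≤ exp (ℓ / 2) ∧ ℓ + 1 ≤ c * ℓ ^ 3 ∧
      (128 + 384 * exp (S / 2)) / (c ^ 2 * ℓ ^ 2) ≤ 1 / 4 ∧
      2 * exp (2 * S - 4 * ℓ) ≤ 1 / (4 * exp ℓ) ∧ exp (-2 * ℓ) ≤ 1 / (8 * exp ℓ) ∧
      exp ℓ * exp (-2 * ℓ) ≤ 1 / ℓ ^ 2 ∧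
      (16 * ℓ ^ 2 + (2 * S * ℓ ^ 8 + 2 * ℓ + ℓ ^ 8)) / (2 * d) + log (8 * exp ℓ) ≤ ℓ ^ 9 := by
  have t8 : ∀ᶠ ℓ : ℝ in atTop, ℓ ^ 8 ≤ exp (ℓ / 2) := by
    have h := (isLittleO_pow_exp_pos_mul_atTop 8 (by norm_num : (0:ℝ) < 1 / 2)).bound (by norm_num : (0:ℝ) < 1)
    filter_upwards [h, eventually_ge_atTop 0] with ℓ h h0
    rw [one_mul, Real.norm_of_nonneg (by positivity), Real.norm_of_nonneg (by positivity)] at h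
    convert h using 2
    ring
  have hS : 0 < exp (S / 2) := exp_pos _
  filter_upwards [t8, eventually_ge_atTop 1, eventually_ge_atTop (2 / c),
    eventually_ge_atTop (4 * (128 + 384 * exp (S / 2)) / c ^ 2),
    eventually_ge_atTop (log 8 + 2 * S), eventually_ge_atTop (log 8),
    eventually_ge_atTop ((16 + (2 * |S| + 3)) / (2 * d) + log 8 + 1)] with ℓ h8 h1 hcℓ h3 h4 h5 h9
  have hℓ0 : 0 < ℓ := by linarith
  have p12 : ℓ ≤ ℓ ^ 2 := by nlinarith
  have p28 : ℓ ^ 2 ≤ ℓ ^ 8 := pow_le_pow_right₀ h1 (by norm_num)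
  have p18 : 1 ≤ ℓ ^ 8 := one_le_pow₀ h1
  refine ⟨h1, h8, ?_, ?_, ?_, ?_, ?_, ?_⟩
  · rw [div_le_iff₀ hc] at hcℓ
    have e : c * ℓ ^ 3 = (ℓ * c) * ℓ ^ 2 := by ring
    rw [e]
    nlinarith
  · rw [div_le_iff₀ (by positivity)] at h3 ⊢
    have : c ^ 2 * ℓ ≤ c ^ 2 * ℓ ^ 2 := by gcongr
    linarith
  · rw [le_div_iff₀ (by positivity)]
    have e : 2 * exp (2 * S - 4 * ℓ) * (4 * exp ℓ) = exp (log 8 + (2 * S - 3 * ℓ)) := by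
      rw [exp_add, exp_log (by norm_num), show 2 * S - 3 * ℓ = (2 * S - 4 * ℓ) + ℓ by ring, exp_add]
      ring
    rw [e, exp_le_one_iff]
    linarith
  · rw [le_div_iff₀ (by positivity)]
    have e : exp (-2 * ℓ) * (8 * exp ℓ) = exp (log 8 - ℓ) := by
      rw [sub_eq_add_neg, exp_add, exp_log (by norm_num), show -ℓ = -2 * ℓ + ℓ by ring, exp_add]
      ring
    rw [e, exp_le_one_iff]
    linarith
  · rw [← exp_add, le_div_iff₀ (by positivity)]
    have : ℓ ^ 2 ≤ exp ℓ := (p28.trans h8).trans (exp_le_exp.2 (by linarith))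
    calc exp (ℓ + -2 * ℓ) * ℓ ^ 2 ≤ exp (ℓ + -2 * ℓ) * exp ℓ := by gcongr
      _ = 1 := by rw [← exp_add, exp_eq_one_iff]; ring
  · rw [Real.log_mul (by norm_num) (exp_pos _).ne', Real.log_exp]
    have hl8 : 0 ≤ log 8 := Real.log_nonneg (by norm_num)
    have hSa := le_abs_self S
    have k1 : (16 * ℓ ^ 2 + (2 * S * ℓ ^ 8 + 2 * ℓ + ℓ ^ 8)) / (2 * d) ≤ (16 + (2 * |S| + 3)) * ℓ ^ 8 / (2 * d) := by
      gcongr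
      nlinarith
    have k2 : log 8 + ℓ ≤ (log 8 + 1) * ℓ ^ 8 := by nlinarith
    calc _ ≤ ((16 + (2 * |S| + 3)) / (2 * d) + log 8 + 1) * ℓ ^ 8 := by
          rw [mul_div_right_comm] at k1
          linarith
      _ ≤ ℓ * ℓ ^ 8 := by gcongr
      _ = ℓ ^ 9 := by ring
end GMP

theorem stmt15 (a σ d : ℝ) (ha0 : 0 ≤ a) (ha1 : a < 1) (hσ : 0 < σ)
    (hd0 : 0 < d) (hdmax : d < σ ^ 2 / (1 - a ^ 2))
    (μv : (n : ℕ) → Fin n → ℝ)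
    (hμ : ∀ n, GM.IsEigs (μv n) ((GM.Amat a n)ᵀ * GM.Amat a n))
    (θn : ℕ → ℝ)
    (hθn : ∀ n, 0 < n → 0 < θn n ∧
      d = (1 / (n : ℝ)) * ∑ i : Fin n, min (θn n) (σ ^ 2 / μv n i)) :
    ∀ α : ℝ, 0 < α →
      ∃ q β₁ β₂ κ K : ℝ, 1 < q ∧ 0 < β₁ ∧ 0 < κ ∧ 0 < K ∧
        ∀ᶠ n : ℕ in Filter.atTop,
          1 - ENNReal.ofReal (K / Real.log n ^ (κ * α)) ≤
            (Measure.pi fun i : Fin n => gaussianReal 0 (σ ^ 2 / μv n i).toNNReal)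
              {x | Real.log (1 /
                      ((Measure.pi fun i : Fin n =>
                          gaussianReal 0 (σ ^ 2 / μv n i - θn n).toNNReal)
                        {y | GM.distortion n x y ≤ d}).toReal)
                    ≤ GM.Jtilt (θn n) (fun i => σ ^ 2 / μv n i) x
                      + β₁ * Real.log n ^ q + β₂} := by
  intro α hα
  have ha : 0 < 1 - a := by linarith
  have ha2 : 0 < 1 - a ^ 2 := by nlinarith
  obtain ⟨S, hSdef⟩ : ∃ S, S = σ ^ 2 / (1 - a) ^ 2 := ⟨_, rfl⟩
  obtain ⟨D, hDdef⟩ : ∃ D, D = σ ^ 2 / (1 - a ^ 2) - d := ⟨_, rfl⟩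
  obtain ⟨c, hc⟩ : ∃ c, c = d * D / (4 * S) := ⟨_, rfl⟩
  have hS : 0 < S := by rw [hSdef]; positivity
  have hD : 0 < D := by linarith
  have hc0 : 0 < c := by rw [hc]; positivity
  refine ⟨9, 1, 0, 2 / α, 384 * exp (S / 2) + 384 * exp (S / 2) / c ^ 2 + 2 * exp (2 * S),
    by norm_num, by norm_num, by positivity, by positivity, ?_⟩
  have hlog : Tendsto (fun n : ℕ => Real.log n) atTop atTop :=
    Real.tendsto_log_atTop.comp tendsto_natCast_atTop_atTop
  have hnat : ∀ᶠ n : ℕ in atTop, 2 * σ ^ 2 / (1 - a ^ 2) ^ 2 / D ≤ n :=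
    tendsto_natCast_atTop_atTop.eventually_ge_atTop _
  filter_upwards [hlog.eventually (GMP.ev_real c S d hc0 hd0), hnat, eventually_gt_atTop 0] with n hev hnD hn
  have hn' : (0:ℝ) < n := by exact_mod_cast hn
  rw [Real.exp_log hn'] at hev
  obtain ⟨h1, h2, h3, h4, h5, h6, h7, h8⟩ := hev
  have hsq : exp (Real.log n / 2) = √n := by
    rw [Real.exp_half, Real.exp_log hn']
  rw [hsq] at h2
  have hμl := fun i => GMP.eig_lower ha0 ha1 (hμ n) i
  have hμ0 : ∀ i, 0 < μv n i := fun i => lt_of_lt_of_le (by positivity) (hμl i)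
  have htr : n * d + n * D / 2 ≤ ∑ i, σ ^ 2 / μv n i := by
    have h := mul_le_mul_of_nonneg_left (GMP.trace_lower ha0 ha1 (hμ n)) (sq_nonneg σ)
    rw [Finset.mul_sum] at h
    simp only [div_eq_mul_inv (σ ^ 2) (μv n _)]
    refine le_trans ?_ h
    rw [div_le_iff₀ hD] at hnD
    have e : σ ^ 2 * (n / (1 - a ^ 2) - 1 / (1 - a ^ 2) ^ 2) = n * (d + D) - (2 * σ ^ 2 / (1 - a ^ 2) ^ 2) / 2 := by
      rw [hDdef]; ring
    rw [e]
    linarith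
  have key := GMP.core hn d (θn n) S c D (Real.log n) hd0 (hθn n hn).1 hS hD hc (fun i => σ ^ 2 / μv n i)
    (fun i => div_pos (by positivity) (hμ0 i)) (fun i => by
      rw [hSdef]; exact div_le_div_of_nonneg_left (by positivity) (by positivity) (hμl i))
    (hθn n hn).2 htr h1 h2 h3 h4 h5 h6 h7 h8
  have e1 : Real.log n ^ (2 / α * α) = Real.log n ^ 2 := by
    rw [div_mul_cancel₀ _ hα.ne']; exact_mod_cast Real.rpow_natCast _ 2
  have e2 : Real.log n ^ (9 : ℝ) = Real.log n ^ 9 := by exact_mod_cast Real.rpow_natCast _ 9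
  rw [e1, e2, one_mul]
  simp only [add_zero]
  exact key

end
end

section
/- Let s² > 0, θ > 0 and x ∈ ℝ. Let Y ~ N(0, max(0, s² − θ)) (so Y ≡ 0 when s² ≤ θ). Then −min(θ, s²)/(2θ) − log E[ exp( −(Y − x)²/(2θ) ) ] = (min(θ, s²)/(2θ))·(x²/s² − 1) + (1/2) log( max(θ, s²)/θ ). -/
open MeasureTheory ProbabilityTheory Real Filter Matrix
open scoped NNReal ENNReal

noncomputable section

theorem stmt16 (s θ x : ℝ) (hs : 0 < s) (hθ : 0 < θ) :
    -(min θ (s ^ 2) / (2 * θ))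
      - Real.log (∫ y, Real.exp (-((y - x) ^ 2) / (2 * θ))
          ∂(gaussianReal 0 (s ^ 2 - θ).toNNReal)) =
    (min θ (s ^ 2) / (2 * θ)) * (x ^ 2 / s ^ 2 - 1)
      + (1 / 2) * Real.log (max θ (s ^ 2) / θ) := by
  rcases le_or_gt (s ^ 2) θ with h | h
  · have h0 : (s ^ 2 - θ).toNNReal = 0 := Real.toNNReal_of_nonpos (by linarith)
    rw [h0, gaussianReal_zero_var, integral_dirac, Real.log_exp, min_eq_right h, max_eq_left h,
      div_self hθ.ne', Real.log_one]
    field_simp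
    ring
  · have hs2 : 0 < s ^ 2 := by positivity
    obtain ⟨v, hv⟩ : ∃ v, v = s ^ 2 - θ := ⟨_, rfl⟩
    have hvpos : 0 < v := by linarith
    have hne : (s ^ 2 - θ).toNNReal ≠ 0 := by
      rw [← hv]; exact (Real.toNNReal_pos.mpr hvpos).ne'
    have hcoe : ((s ^ 2 - θ).toNNReal : ℝ) = v := by
      rw [← hv]; exact Real.coe_toNNReal _ hvpos.le
    have hsv : s ^ 2 = v + θ := by linarith
    have hvθ : 0 < v + θ := by linarith
    have key : (∫ y, Real.exp (-((y - x) ^ 2) / (2 * θ))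
          ∂(gaussianReal 0 (s ^ 2 - θ).toNNReal))
        = Real.sqrt (θ / s ^ 2) * Real.exp (-(x ^ 2 / (2 * s ^ 2))) := by
      rw [integral_gaussianReal_eq_integral_smul hne]
      have e : ∀ y : ℝ, gaussianPDFReal 0 (s ^ 2 - θ).toNNReal y
            • Real.exp (-((y - x) ^ 2) / (2 * θ))
          = ((Real.sqrt (2 * π * v))⁻¹ * Real.exp (-(x ^ 2 / (2 * s ^ 2))))
            * (fun z : ℝ => Real.exp (-(s ^ 2 / (2 * v * θ)) * z ^ 2)) (y - v * x / s ^ 2) := by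
        intro y
        beta_reduce
        rw [gaussianPDFReal, hcoe, smul_eq_mul, mul_assoc (Real.sqrt _)⁻¹,
          mul_assoc (Real.sqrt _)⁻¹, ← Real.exp_add, ← Real.exp_add]
        congr 2
        rw [hsv]
        field_simp
        ring
      simp_rw [e]
      rw [integral_const_mul, integral_sub_right_eq_self
        (fun z : ℝ => Real.exp (-(s ^ 2 / (2 * v * θ)) * z ^ 2)), integral_gaussian]
      have : π / (s ^ 2 / (2 * v * θ)) = (2 * π * v) * (θ / s ^ 2) := by
        field_simp
      rw [this, Real.sqrt_mul (x := 2 * π * v) (by positivity) (θ / s ^ 2)]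
      have : Real.sqrt (2 * π * v) ≠ 0 := by positivity
      field_simp
    rw [key, Real.log_mul (by positivity) (by positivity), Real.log_exp,
      Real.log_sqrt (by positivity), min_eq_left h.le, max_eq_right h.le,
      Real.log_div hθ.ne' hs2.ne', Real.log_div hs2.ne' hθ.ne']
    field_simp
    ring

end
end
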